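/- Assume n ≡ 0 (mod ℓ) (so n ≥ ℓ ≥ 2). Then ẽ_j μ_0^{(n)} = ẽ_j (n) = 0 for every j ∈ Z/ℓ; and for every 1 ≤ i ≤ N = n/ℓ and every j ∈ Z/ℓ: if j ≢ n−1 (mod ℓ) then ẽ_j μ_i^{(n)} = 0, while if j ≡ n−1 (mod ℓ) then ẽ_j μ_i^{(n)} = μ_{i−1}^{(n−1)} (which is defined, since ⌊(n−1)/ℓ⌋ = N − 1 when ℓ divides n). -/

import Mathlib

noncomputable section

open scoped BigOperators Classical

namespace FockCrystal

variable (ℓ : ℕ)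

/-- The `ℓ`-residue of a cell `(r, c)` (0-indexed rows and columns): `(c - r) mod ℓ`. -/
def res (x : ℕ × ℕ) : ZMod ℓ := (((x.2 : ℤ) - (x.1 : ℤ) : ℤ) : ZMod ℓ)

/-- `x` is an addable cell of `μ`: `x ∉ μ` and `μ ∪ {x}` is again a Young diagram. -/
def IsAddableCell (μ : YoungDiagram) (x : ℕ × ℕ) : Prop :=
  x ∉ μ ∧ IsLowerSet (insert x (μ.cells : Set (ℕ × ℕ)))

/-- `x` is a removable cell of `μ`: `x ∈ μ` and `μ \ {x}` is again a Young diagram. -/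
def IsRemovableCell (μ : YoungDiagram) (x : ℕ × ℕ) : Prop :=
  x ∈ μ ∧ IsLowerSet ((μ.cells.erase x : Finset (ℕ × ℕ)) : Set (ℕ × ℕ))

/-- The finite set of `i`-addable cells of `μ`. -/
def addables (i : ZMod ℓ) (μ : YoungDiagram) : Finset (ℕ × ℕ) :=
  (Finset.range (μ.cells.card + 1) ×ˢ Finset.range (μ.cells.card + 1)).filter
    fun x => IsAddableCell μ x ∧ res ℓ x = i

/-- The finite set of `i`-removable cells of `μ`. -/
def removables (i : ZMod ℓ) (μ : YoungDiagram) : Finset (ℕ × ℕ) :=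
  μ.cells.filter fun x => IsRemovableCell μ x ∧ res ℓ x = i

/-- Adding a cell to a Young diagram (returns `μ` unchanged if the result would not be a
Young diagram). -/
def addCell (μ : YoungDiagram) (x : ℕ × ℕ) : YoungDiagram :=
  if h : IsLowerSet (insert x (μ.cells : Set (ℕ × ℕ))) then
    ⟨insert x μ.cells, by simpa using h⟩
  else μ

/-- Removing a cell from a Young diagram (returns `μ` unchanged if the result would not be
a Young diagram). -/
def eraseCell (μ : YoungDiagram) (x : ℕ × ℕ) : YoungDiagram :=
  if h : IsLowerSet ((μ.cells.erase x : Finset (ℕ × ℕ)) : Set (ℕ × ℕ)) then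
    ⟨μ.cells.erase x, h⟩
  else μ

/-- The letter (`some true` = `A` for addable, `some false` = `R` for removable) contributed
to the `i`-word of `μ` by row `r`; for a fixed residue a row contributes at most one letter. -/
def rowLetter (i : ZMod ℓ) (μ : YoungDiagram) (r : ℕ) : Option Bool :=
  if ∃ c, (r, c) ∈ addables ℓ i μ then some true
  else if ∃ c, (r, c) ∈ removables ℓ i μ then some false
  else none

/-- The `i`-word of `μ`, read from the bottom row up, with each letter recorded together
with its row index. -/
def wordP (i : ZMod ℓ) (μ : YoungDiagram) : List (Bool × ℕ) :=
  ((List.range (μ.cells.card + 2)).reverse).filterMap fun r =>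
    (rowLetter ℓ i μ r).map fun b => (b, r)

/-- One step of the `AR`-cancellation (stack algorithm): an `R` cancels a directly
preceding `A`. -/
def cancelStep (st : List (Bool × ℕ)) (c : Bool × ℕ) : List (Bool × ℕ) :=
  if c.1 = false ∧ (st.getLast?.map Prod.fst) = some true then st.dropLast else st ++ [c]

/-- Repeatedly delete adjacent occurrences of `AR` until none remain (computed by the
one-pass stack algorithm, which yields the unique `AR`-reduced word `R…RA…A`). -/
def reduceWord (w : List (Bool × ℕ)) : List (Bool × ℕ) := w.foldl cancelStep []

/-- The row of the `i`-good cell of `μ`: the removable cell corresponding to the rightmost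
`R` remaining in the reduced `i`-word (if any). -/
def goodRow (i : ZMod ℓ) (μ : YoungDiagram) : Option ℕ :=
  (((reduceWord (wordP ℓ i μ)).filter fun p => p.1 = false).getLast?).map Prod.snd

/-- The row of the `i`-cogood cell of `μ`: the addable cell corresponding to the leftmost
`A` remaining in the reduced `i`-word (if any). -/
def cogoodRow (i : ZMod ℓ) (μ : YoungDiagram) : Option ℕ :=
  (((reduceWord (wordP ℓ i μ)).filter fun p => p.1 = true).head?).map Prod.snd

/-- The Kashiwara operator `ẽᵢ`: remove the `i`-good cell if there is one, else `0`
(modelled by `Option`, `none = 0`). -/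
def etilde (i : ZMod ℓ) (μ : YoungDiagram) : Option YoungDiagram :=
  (goodRow ℓ i μ).map fun r => eraseCell μ (r, μ.rowLen r - 1)

/-- The Kashiwara operator `f̃ᵢ`: add the `i`-cogood cell if there is one, else `0`
(modelled by `Option`, `none = 0`). -/
def ftilde (i : ZMod ℓ) (μ : YoungDiagram) : Option YoungDiagram :=
  (cogoodRow ℓ i μ).map fun r => addCell μ (r, μ.rowLen r)

/-- The list of row lengths of the partition `μ_i^{(n)}`:
`μ₀^{(n)} = (n)`, and for `1 ≤ i ≤ N = ⌊n/ℓ⌋`,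
`μ_i^{(n)} = ((N-i)ℓ + ℓ-1, (ℓ-1)^q, s)` where `n - ((N-i)ℓ + ℓ-1) = q(ℓ-1) + s`,
`0 ≤ s ≤ ℓ-2`, and the last part `s` is omitted when `s = 0`. -/
def muList (ℓ n i : ℕ) : List ℕ :=
  if i = 0 then [n]
  else
    ((n / ℓ - i) * ℓ + (ℓ - 1)) ::
      (List.replicate ((n - ((n / ℓ - i) * ℓ + (ℓ - 1))) / (ℓ - 1)) (ℓ - 1)
        ++ (if (n - ((n / ℓ - i) * ℓ + (ℓ - 1))) % (ℓ - 1) = 0 then []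
            else [(n - ((n / ℓ - i) * ℓ + (ℓ - 1))) % (ℓ - 1)]))

theorem stepT (st : List (Bool × ℕ)) (r : ℕ) : cancelStep st (true, r) = st ++ [(true, r)] := by
  simp [cancelStep]

/-- word from the rows `k, …, k+m-1`, bottom up. -/
def wseg (f : ℕ → Option Bool) (k m : ℕ) : List (Bool × ℕ) :=
  ((List.range' k m).reverse).filterMap fun r => (f r).map fun b => (b, r)

theorem wseg_succ (f : ℕ → Option Bool) (k m : ℕ) :
    reduceWord (wseg f k (m+1)) = match f k with
      | none => reduceWord (wseg f (k+1) m)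
      | some b => cancelStep (reduceWord (wseg f (k+1) m)) (b, k) := by
  unfold wseg reduceWord
  rw [List.range'_succ, List.reverse_cons, List.filterMap_append, List.foldl_append]
  cases h : f k <;> simp [h]

theorem wordP_eq (j : ZMod ℓ) (μ : YoungDiagram) :
    wordP ℓ j μ = wseg (rowLetter ℓ j μ) 0 (μ.cells.card + 2) := by
  simp [wordP, wseg, List.range_eq_range']

theorem red_none (f : ℕ → Option Bool) (B : ℕ) (hB : ∀ r, B ≤ r → f r = none)
    (H : ∀ r, f r = some false → ∃ a, r < a ∧ f a = some true ∧
      ∀ b, r < b → b < a → f b ≠ some false) (m : ℕ) :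
    ∀ k, k + m = B → (∀ p ∈ reduceWord (wseg f k m), p.1 = true) ∧
      ((∃ a, k ≤ a ∧ f a = some true ∧ ∀ b, k ≤ b → b < a → f b ≠ some false) →
        reduceWord (wseg f k m) ≠ []) := by
  induction m with
  | zero =>
    intro k hk
    refine ⟨by simp [wseg, reduceWord], ?_⟩
    rintro ⟨a, ha, hfa, -⟩
    rw [hB a (by omega)] at hfa
    simp at hfa
  | succ m ih =>
    intro k hk
    obtain ⟨h1, h2⟩ := ih (k+1) (by omega)
    rw [wseg_succ]
    rcases hf : f k with _ | b
    · refine ⟨h1, ?_⟩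
      rintro ⟨a, ha, hfa, hb⟩
      apply h2
      have : a ≠ k := by rintro rfl; simp [hf] at hfa
      exact ⟨a, by omega, hfa, fun b hb1 hb2 => hb b (by omega) hb2⟩
    · cases b
      · have hne : reduceWord (wseg f (k+1) m) ≠ [] := by
          apply h2
          obtain ⟨a, ha, hfa, hb⟩ := H k hf
          exact ⟨a, ha, hfa, fun b hb1 hb2 => hb b (by omega) hb2⟩
        constructor
        · intro p hp
          have hc : cancelStep (reduceWord (wseg f (k+1) m)) (false, k)
              = (reduceWord (wseg f (k+1) m)).dropLast := by
            unfold cancelStep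
            rw [if_pos]
            refine ⟨rfl, ?_⟩
            rw [List.getLast?_eq_some_getLast hne]
            simp [h1 _ (List.getLast_mem hne)]
          simp only [hc] at hp
          exact h1 p (List.dropLast_subset _ hp)
        · rintro ⟨a, ha, hfa, hb⟩
          exfalso
          rcases Nat.lt_or_ge k a with h | h
          · exact hb k le_rfl h hf
          · obtain rfl : a = k := by omega
            simp [hf] at hfa
      · simp only [stepT]
        refine ⟨?_, by simp⟩
        intro p hp
        rcases List.mem_append.1 hp with h | h
        · exact h1 p h
        · simp at h; simp [h]

theorem red_some (f : ℕ → Option Bool) (t B : ℕ) (ht : f t = some false)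
    (hgt : ∀ r, t < r → f r = none) (hlt : ∀ r, r < t → f r ≠ some false) (m : ℕ) :
    ∀ k, k + m = B → (reduceWord (wseg f k m)).filter (fun p => p.1 = false)
      = (if k ≤ t ∧ t < B then [(false, t)] else []) ∧ (t < k → reduceWord (wseg f k m) = []) := by
  induction m with
  | zero =>
    intro k hk
    have : ¬ (k ≤ t ∧ t < B) := by omega
    rw [if_neg this]
    simp [wseg, reduceWord]
  | succ m ih =>
    intro k hk
    obtain ⟨h1, h2⟩ := ih (k+1) (by omega)
    rw [wseg_succ]
    rcases lt_trichotomy k t with h | rfl | h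
    · have e : (k ≤ t ∧ t < B) ↔ (k + 1 ≤ t ∧ t < B) := by omega
      refine ⟨?_, by omega⟩
      simp only [e]
      rcases hf : f k with _ | b
      · exact h1
      · cases b
        · exact absurd hf (hlt k h)
        · simp only [stepT]
          rw [List.filter_append, h1]
          simp
    · rw [ht]
      simp only [h2 (by omega)]
      refine ⟨?_, by omega⟩
      rw [if_pos (by omega)]
      simp [cancelStep]
    · rw [hgt k h]
      refine ⟨?_, fun _ => h2 (by omega)⟩
      simp only [h2 (by omega : t < k + 1)]
      rw [if_neg (by omega)]
      simp

theorem addable_imp {μ : YoungDiagram} {r c : ℕ} (h : IsAddableCell μ (r, c)) :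
    c = μ.rowLen r ∧ (r = 0 ∨ μ.rowLen r < μ.rowLen (r - 1)) := by
  obtain ⟨h1, h2⟩ := h
  rw [YoungDiagram.mem_iff_lt_rowLen] at h1
  have hc : c = μ.rowLen r := by
    by_contra hne
    have := h2 (show ((r, c - 1) : ℕ × ℕ) ≤ (r, c) from ⟨le_rfl, by simp⟩) (Set.mem_insert _ _)
    rcases this with h | h
    · simp at h; omega
    · have := YoungDiagram.mem_iff_lt_rowLen.1 ((YoungDiagram.mem_cells _).1 (Finset.mem_coe.1 h))
      omega
  refine ⟨hc, ?_⟩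
  by_cases hr : r = 0
  · exact Or.inl hr
  · right
    have := h2 (show ((r - 1, c) : ℕ × ℕ) ≤ (r, c) from ⟨by simp, le_rfl⟩) (Set.mem_insert _ _)
    rcases this with h | h
    · simp at h; omega
    · have := YoungDiagram.mem_iff_lt_rowLen.1 ((YoungDiagram.mem_cells _).1 (Finset.mem_coe.1 h))
      omega

theorem addable_of {μ : YoungDiagram} {r : ℕ} (h : r = 0 ∨ μ.rowLen r < μ.rowLen (r - 1)) :
    IsAddableCell μ (r, μ.rowLen r) := by
  refine ⟨by rw [YoungDiagram.mem_iff_lt_rowLen]; omega, ?_⟩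
  rintro ⟨x1, x2⟩ ⟨y1, y2⟩ ⟨hy1, hy2⟩ hx
  simp only at hy1 hy2
  simp only [Set.mem_insert_iff, Finset.mem_coe, YoungDiagram.mem_cells,
    YoungDiagram.mem_iff_lt_rowLen, Prod.mk.injEq] at hx ⊢
  have anti := μ.rowLen_anti y1 x1 hy1
  rcases hx with ⟨rfl, rfl⟩ | hx
  · by_cases hh : y1 = x1
    · subst hh; omega
    · have := μ.rowLen_anti y1 (x1 - 1) (by omega)
      omega
  · omega

theorem removable_imp {μ : YoungDiagram} {r c : ℕ} (h : IsRemovableCell μ (r, c)) :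
    c + 1 = μ.rowLen r ∧ μ.rowLen (r + 1) < μ.rowLen r := by
  obtain ⟨h1, h2⟩ := h
  rw [YoungDiagram.mem_iff_lt_rowLen] at h1
  have key : ∀ x : ℕ × ℕ, (r, c) ≤ x → x ≠ (r, c) → x ∉ μ := by
    intro x hx hne hmem
    have := h2 hx (by simp [hne, hmem])
    simp at this
  have k1 := key (r, c + 1) ⟨le_rfl, by simp⟩ (by simp)
  have k2 := key (r + 1, c) ⟨by simp, le_rfl⟩ (by simp)
  rw [YoungDiagram.mem_iff_lt_rowLen] at k1 k2
  omega

theorem removable_of {μ : YoungDiagram} {r : ℕ} (h : μ.rowLen (r + 1) < μ.rowLen r) :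
    IsRemovableCell μ (r, μ.rowLen r - 1) := by
  refine ⟨by rw [YoungDiagram.mem_iff_lt_rowLen]; omega, ?_⟩
  rintro ⟨x1, x2⟩ ⟨y1, y2⟩ ⟨hy1, hy2⟩ hx
  simp only at hy1 hy2
  simp only [Finset.mem_coe, Finset.mem_erase, YoungDiagram.mem_cells,
    YoungDiagram.mem_iff_lt_rowLen, Prod.mk.injEq, ne_eq, not_and] at hx ⊢
  have anti := μ.rowLen_anti y1 x1 hy1
  refine ⟨?_, by omega⟩
  rintro rfl rfl
  by_cases hh : x1 = y1
  · subst hh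
    have := hx.1 rfl
    omega
  · have := μ.rowLen_anti (y1 + 1) x1 (by omega)
    omega

theorem rowLen_le_card (μ : YoungDiagram) (r : ℕ) : μ.rowLen r ≤ μ.cells.card := by
  rw [YoungDiagram.rowLen_eq_card]
  exact Finset.card_le_card (Finset.filter_subset _ _)

theorem colLen_le_card (μ : YoungDiagram) (r : ℕ) : μ.colLen r ≤ μ.cells.card := by
  rw [YoungDiagram.colLen_eq_card]
  exact Finset.card_le_card (Finset.filter_subset _ _)

theorem row_bound {μ : YoungDiagram} {r : ℕ} (h : 0 < μ.rowLen r) : r < μ.cells.card := by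
  rw [← YoungDiagram.mem_iff_lt_rowLen, YoungDiagram.mem_iff_lt_colLen] at h
  exact h.trans_le (colLen_le_card μ 0)

theorem mem_addables {j : ZMod ℓ} {μ : YoungDiagram} {r : ℕ} :
    (∃ c, (r, c) ∈ addables ℓ j μ) ↔
      (r = 0 ∨ μ.rowLen r < μ.rowLen (r - 1)) ∧ (μ.rowLen r : ZMod ℓ) - r = j := by
  constructor
  · rintro ⟨c, hc⟩
    obtain ⟨-, h1, h2⟩ := Finset.mem_filter.1 hc
    obtain ⟨rfl, h⟩ := addable_imp h1
    refine ⟨h, ?_⟩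
    simpa [res] using h2
  · rintro ⟨h1, h2⟩
    refine ⟨μ.rowLen r, Finset.mem_filter.2 ⟨?_, addable_of h1, by simpa [res] using h2⟩⟩
    have := rowLen_le_card μ r
    have : r < μ.cells.card + 1 := by
      rcases h1 with h | h
      · omega
      · have := row_bound (μ := μ) (r := r - 1) (by omega)
        omega
    simp only [Finset.mem_product, Finset.mem_range]
    omega

theorem mem_removables {j : ZMod ℓ} {μ : YoungDiagram} {r : ℕ} :
    (∃ c, (r, c) ∈ removables ℓ j μ) ↔
      μ.rowLen (r + 1) < μ.rowLen r ∧ (μ.rowLen r : ZMod ℓ) - 1 - r = j := by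
  constructor
  · rintro ⟨c, hc⟩
    obtain ⟨-, h1, h2⟩ := Finset.mem_filter.1 hc
    obtain ⟨h3, h⟩ := removable_imp h1
    refine ⟨h, ?_⟩
    rw [← h3]
    simpa [res] using h2
  · rintro ⟨h1, h2⟩
    have h3 := removable_of h1
    refine ⟨μ.rowLen r - 1, Finset.mem_filter.2 ⟨(YoungDiagram.mem_cells _).2 h3.1, h3, ?_⟩⟩
    obtain ⟨x, hx⟩ : ∃ x, μ.rowLen r = x + 1 := ⟨μ.rowLen r - 1, by omega⟩
    rw [hx] at h2 ⊢
    simpa [res] using h2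

theorem letterA {j : ZMod ℓ} {μ : YoungDiagram} {r : ℕ} : rowLetter ℓ j μ r = some true ↔
      (r = 0 ∨ μ.rowLen r < μ.rowLen (r - 1)) ∧ (μ.rowLen r : ZMod ℓ) - r = j := by
  unfold rowLetter
  rw [mem_addables, mem_removables]
  split_ifs <;> simp_all

theorem letterR {j : ZMod ℓ} {μ : YoungDiagram} {r : ℕ} : rowLetter ℓ j μ r = some false ↔
      ¬ ((r = 0 ∨ μ.rowLen r < μ.rowLen (r - 1)) ∧ (μ.rowLen r : ZMod ℓ) - r = j) ∧
      μ.rowLen (r + 1) < μ.rowLen r ∧ (μ.rowLen r : ZMod ℓ) - 1 - r = j := by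
  unfold rowLetter
  rw [mem_addables, mem_removables]
  split_ifs <;> simp_all

theorem letter_big {j : ZMod ℓ} {μ : YoungDiagram} {r : ℕ} (h : μ.cells.card + 2 ≤ r) :
    rowLetter ℓ j μ r = none := by
  unfold rowLetter
  rw [mem_addables, mem_removables]
  have h1 : ¬ 0 < μ.rowLen r := fun h' => by have := row_bound h'; omega
  have h2 : ¬ 0 < μ.rowLen (r-1) := fun h' => by have := row_bound h'; omega
  rw [if_neg, if_neg]
  · rintro ⟨h, -⟩; omega
  · rintro ⟨h, -⟩; omega

theorem etilde_none {j : ZMod ℓ} {μ : YoungDiagram}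
    (H : ∀ r, μ.rowLen (r + 1) < μ.rowLen r → (μ.rowLen r : ZMod ℓ) - 1 - r = j →
      ∃ a, r < a ∧ μ.rowLen a < μ.rowLen (a - 1) ∧ (μ.rowLen a : ZMod ℓ) - a = j ∧
      ∀ b, r < b → b < a → μ.rowLen (b + 1) < μ.rowLen b → (μ.rowLen b : ZMod ℓ) - 1 - b ≠ j) :
    etilde ℓ j μ = none := by
  have := (red_none (rowLetter ℓ j μ) (μ.cells.card + 2) (fun r hr => letter_big ℓ hr) (by
    intro r hr
    obtain ⟨-, h1, h2⟩ := (letterR ℓ).1 hr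
    obtain ⟨a, ha, ha1, ha2, ha3⟩ := H r h1 h2
    refine ⟨a, ha, (letterA ℓ).2 ⟨Or.inr ha1, ha2⟩, ?_⟩
    intro b hb1 hb2 hb
    obtain ⟨-, h1, h2⟩ := (letterR ℓ).1 hb
    exact ha3 b hb1 hb2 h1 h2) (μ.cells.card + 2) 0 (by omega)).1
  have e : (reduceWord (wordP ℓ j μ)).filter (fun p => p.1 = false) = [] := by
    rw [wordP_eq, List.filter_eq_nil_iff]
    intro p hp
    simp [this p hp]
  unfold etilde goodRow
  rw [e]
  rfl

theorem etilde_some {j : ZMod ℓ} {μ : YoungDiagram} (t : ℕ)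
    (h1 : μ.rowLen (t + 1) < μ.rowLen t) (h2 : (μ.rowLen t : ZMod ℓ) - 1 - t = j)
    (hA : ∀ r, t ≤ r → (r = 0 ∨ μ.rowLen r < μ.rowLen (r - 1)) → (μ.rowLen r : ZMod ℓ) - r ≠ j)
    (hR : ∀ r, μ.rowLen (r + 1) < μ.rowLen r → (μ.rowLen r : ZMod ℓ) - 1 - r = j → r = t) :
    etilde ℓ j μ = some (eraseCell μ (t, μ.rowLen t - 1)) := by
  have hgt : ∀ r, t < r → rowLetter ℓ j μ r = none := by
    intro r hr
    unfold rowLetter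
    rw [mem_addables, mem_removables, if_neg, if_neg]
    · rintro ⟨h, h'⟩
      have := hR r h h'
      omega
    · rintro ⟨h, h'⟩
      exact hA r hr.le h h'
  have := (red_some (rowLetter ℓ j μ) t (μ.cells.card + 2)
    ((letterR ℓ).2 ⟨fun h => hA t le_rfl h.1 h.2, h1, h2⟩) hgt (by
      intro r hr h
      obtain ⟨-, h1, h2⟩ := (letterR ℓ).1 h
      have := hR r h1 h2
      omega) (μ.cells.card + 2) 0 (by omega)).1
  have hb := row_bound (μ := μ) (r := t) (by omega)
  rw [if_pos (by omega), ← wordP_eq] at this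
  unfold etilde goodRow
  rw [this]
  rfl

theorem erase_eq {μ μ' : YoungDiagram} (t : ℕ) (h1 : μ.rowLen (t + 1) < μ.rowLen t)
    (h : ∀ r, μ'.rowLen r = if r = t then μ.rowLen t - 1 else μ.rowLen r) :
    eraseCell μ (t, μ.rowLen t - 1) = μ' := by
  unfold eraseCell
  rw [dif_pos (removable_of h1).2]
  ext ⟨x, y⟩
  simp only [Finset.mem_erase, YoungDiagram.mem_cells, YoungDiagram.mem_iff_lt_rowLen, h]
  simp only [ne_eq, Prod.mk.injEq, not_and]
  split_ifs with hx
  · subst hx; simp; omega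
  · simp [hx]

theorem rowLen_getD (μ : YoungDiagram) (r : ℕ) : μ.rowLen r = μ.rowLens.getD r 0 := by
  by_cases h : r < μ.colLen 0
  · simp [YoungDiagram.rowLens, List.getD_eq_getElem?_getD, h]
  · have : ¬ 0 < μ.rowLen r := by
      rwa [← YoungDiagram.mem_iff_lt_rowLen, YoungDiagram.mem_iff_lt_colLen]
    simp [YoungDiagram.rowLens, List.getD_eq_getElem?_getD, h]
    omega

theorem rowLen_form {μ : YoungDiagram} {a d q s : ℕ}
    (h : μ.rowLens = a :: (List.replicate q d ++ if s = 0 then [] else [s])) (r : ℕ) :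
    μ.rowLen r = if r = 0 then a else if r ≤ q then d else if r = q + 1 then s else 0 := by
  rw [rowLen_getD, h]
  rcases r with _ | r
  · simp
  · rw [List.getD_cons_succ]
    simp only [List.getD_eq_getElem?_getD, List.getElem?_append,
      List.length_replicate, List.getElem?_replicate]
    by_cases h1 : r < q
    · simp [h1, Nat.succ_le_of_lt h1]
    · have h2 : ¬ (r + 1 ≤ q) := by omega
      simp only [h1, h2, if_false]
      by_cases h3 : r = q
      · subst h3
        by_cases hs : s = 0 <;> simp [hs]
      · have : r - q = (r - q - 1) + 1 := by omega
        rw [this]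
        by_cases hs : s = 0 <;> simp [hs, h3]

theorem core {μ μ' : YoungDiagram} {a d q s q' s' : ℕ} (hd : 1 ≤ d) (hℓ : ℓ = d + 1)
    (hs : s < d) (hs' : s' < d) (ha : ((a : ℕ) : ZMod ℓ) = -1) (ha0 : 0 < a)
    (hsq : (s : ZMod ℓ) = q + 1)
    (hq : q * d + s = q' * d + s' + 1)
    (h : μ.rowLens = a :: (List.replicate q d ++ if s = 0 then [] else [s]))
    (h' : μ'.rowLens = a :: (List.replicate q' d ++ if s' = 0 then [] else [s']))
    (j : ZMod ℓ) : (j ≠ -1 → etilde ℓ j μ = none) ∧ (j = -1 → etilde ℓ j μ = some μ') := by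
  have L := rowLen_form h
  have L' := rowLen_form h'
  have hdz : (d : ZMod ℓ) = -1 := by
    have : ((d + 1 : ℕ) : ZMod ℓ) = 0 := by rw [← hℓ]; simp
    push_cast at this
    linear_combination this
  have hone : (1 : ZMod ℓ) ≠ 0 := by
    haveI : Fact (1 < ℓ) := ⟨by omega⟩
    exact one_ne_zero
  have hs0 : (s : ZMod ℓ) = 0 → s = 0 := by
    intro hz
    rw [ZMod.natCast_eq_zero_iff] at hz
    exact Nat.eq_zero_of_dvd_of_lt hz (by omega)
  have L0 : μ.rowLen 0 = a := by simp [L]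
  have Lq : (μ.rowLen q : ZMod ℓ) = -1 := by
    rw [L]
    split_ifs <;> first | assumption | omega
  have Lqpos : 0 < μ.rowLen q := by
    rw [L]
    split_ifs <;> omega
  have Lq1 : μ.rowLen (q + 1) = s := by simp [L]
  have Lbig : ∀ r, q + 1 < r → μ.rowLen r = 0 := by
    intro r hr
    rw [L, if_neg (by omega), if_neg (by omega), if_neg (by omega)]
  have Lmid : ∀ r, 1 ≤ r → r ≤ q → μ.rowLen r = d := by
    intro r hr hr'
    rw [L, if_neg (by omega), if_pos (by omega)]
  -- positions of removable cells
  have pos : ∀ r, μ.rowLen (r + 1) < μ.rowLen r →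
      (r = 0 ∧ 1 ≤ q) ∨ r = q ∨ (r = q + 1 ∧ 0 < s) := by
    intro r hr
    by_contra hcon
    by_cases h1 : r ≤ q
    · rw [Lmid r (by omega) h1, Lmid (r+1) (by omega) (by omega)] at hr
      omega
    · by_cases h2 : r = q + 1
      · subst h2
        rw [Lq1] at hr
        omega
      · rw [Lbig r (by omega)] at hr
        omega
  constructor
  · intro hj
    apply etilde_none
    intro r hr hres
    rcases pos r hr with ⟨rfl, hq1⟩ | rfl | ⟨rfl, hs1⟩
    · refine ⟨1, by omega, by simpa using hr, ?_, by intros; omega⟩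
      rw [Lmid 1 le_rfl hq1, hdz, ← hres, L0, ha]
      push_cast; ring
    · have hsne : s ≠ 0 := by
        rintro rfl
        apply hj
        rw [← hres, Lq]
        push_cast at hsq
        linear_combination hsq
      refine ⟨r + 2, by omega, ?_, ?_, ?_⟩
      · rw [Lbig (r+2) (by omega), show r + 2 - 1 = r + 1 by omega, Lq1]; omega
      · rw [Lbig (r+2) (by omega), ← hres, Lq]
        push_cast; ring
      · intro b hb1 hb2 _ hb
        obtain rfl : b = r + 1 := by omega
        apply hj
        rw [← hb, Lq1, hsq]
        push_cast; ring
    · exfalso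
      apply hj
      rw [← hres, Lq1, hsq]
      push_cast; ring
  · rintro rfl
    have hqs : s = 0 → 1 ≤ q := by
      rintro rfl
      by_contra hh
      obtain rfl : q = 0 := by omega
      apply hone
      push_cast at hsq
      linear_combination -hsq
    obtain ⟨t, ht⟩ : ∃ t, t = if s = 0 then q else q + 1 := ⟨_, rfl⟩
    have hrem : μ.rowLen (t + 1) < μ.rowLen t := by
      subst ht
      split_ifs with h0
      · rw [Lq1]; omega
      · rw [Lq1, Lbig _ (by omega)]; omega
    rw [etilde_some ℓ t hrem, erase_eq t hrem]
    · intro r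
      by_cases h0 : s = 0
      · have hq1 := hqs h0
        rw [if_pos h0] at ht
        obtain ⟨p, rfl⟩ : ∃ p, q = p + 1 := ⟨q - 1, by omega⟩
        have e1 : q' = p := by
          have e : p * d + (d - 1) = q' * d + s' := by rw [add_mul] at hq; omega
          have := congrArg (· / d) e
          simpa [Nat.add_div_of_dvd_right, Nat.mul_add_div, mul_comm _ d, Nat.mul_add_div (show 0 < d by omega), Nat.div_eq_of_lt hs', Nat.div_eq_of_lt (show d - 1 < d by omega)] using this.symm
        subst e1
        have e2 : s' = d - 1 := by rw [add_mul] at hq; omega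
        rw [L', L, L]
        subst ht
        split_ifs <;> first | contradiction | omega
      · rw [if_neg h0] at ht
        have e : q * d + (s - 1) = q' * d + s' := by omega
        have e1 : q' = q := by
          have := congrArg (· / d) e
          simpa [mul_comm _ d, Nat.mul_add_div (show 0 < d by omega), Nat.div_eq_of_lt hs', Nat.div_eq_of_lt (show s - 1 < d by omega)] using this.symm
        subst e1
        have e2 : s' = s - 1 := by omega
        rw [L', L, L]
        subst ht
        split_ifs <;> first | contradiction | omega
    · subst ht
      split_ifs with h0
      · rw [Lq]
        subst h0
        push_cast at hsq
        linear_combination hsq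
      · rw [Lq1, hsq]
        push_cast; ring
    · intro r hr hadd hres
      have c0 : ¬ (r = q ∧ s = 0) := by
        rintro ⟨rfl, rfl⟩
        apply hone
        rw [Lq] at hres
        push_cast at hsq
        linear_combination hres - hsq
      have c1 : r ≠ q + 1 := by
        rintro rfl
        apply hone
        rw [Lq1, hsq] at hres
        push_cast at hres
        linear_combination hres
      have hr2 : q + 1 < r := by
        subst ht
        split_ifs at hr with h0 <;> omega
      by_cases h2 : r = q + 2
      · subst h2
        rw [Lbig (q+2) (by omega), show q + 2 - 1 = q + 1 by omega, Lq1] at hadd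
        rw [Lbig (q+2) (by omega)] at hres
        have := hs0 (by rw [hsq]; push_cast at hres; linear_combination -hres)
        omega
      · rw [Lbig (r - 1) (by omega)] at hadd
        omega
    · intro r hr hres
      rcases pos r hr with ⟨rfl, hq1⟩ | rfl | ⟨rfl, hs1⟩
      · exfalso
        apply hone
        rw [L0, ha] at hres
        push_cast at hres
        linear_combination -hres
      · rw [Lq] at hres
        have := hs0 (by rw [hsq]; linear_combination -hres)
        rw [ht, if_pos this]
      · rw [ht, if_neg (by omega)]

/-- Assume `ℓ ∣ n` (and `n ≥ ℓ ≥ 2`).  Then `ẽⱼ μ₀^{(n)} = ẽⱼ (n) = 0`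
for every residue `j`; and for every `1 ≤ i ≤ N = n/ℓ` and every `j ∈ ℤ/ℓ`: if
`j ≢ n-1 (mod ℓ)` then `ẽⱼ μ_i^{(n)} = 0`, while if `j ≡ n-1 (mod ℓ)` then
`ẽⱼ μ_i^{(n)} = μ_{i-1}^{(n-1)}` (which is defined, since `⌊(n-1)/ℓ⌋ = N - 1` when
`ℓ ∣ n`).  Partitions are encoded as Young diagrams and specified by their lists of row
lengths. -/
theorem statement13 (n : ℕ) (hℓ : 2 ≤ ℓ) (hn : ℓ ≤ n) (hmod : ℓ ∣ n) :
    (∀ μ₀ : YoungDiagram, μ₀.rowLens = muList ℓ n 0 →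
      ∀ j : ZMod ℓ, etilde ℓ j μ₀ = none)
    ∧ (∀ i : ℕ, 1 ≤ i → i ≤ n / ℓ →
        ∀ μ μ' : YoungDiagram,
          μ.rowLens = muList ℓ n i → μ'.rowLens = muList ℓ (n - 1) (i - 1) →
          ∀ j : ZMod ℓ,
            (j ≠ ((n - 1 : ℕ) : ZMod ℓ) → etilde ℓ j μ = none)
            ∧ (j = ((n - 1 : ℕ) : ZMod ℓ) → etilde ℓ j μ = some μ')) := by
  have hℓ0 : ((ℓ : ℕ) : ZMod ℓ) = 0 := by simp
  have hn0 : (n : ZMod ℓ) = 0 := (ZMod.natCast_eq_zero_iff n ℓ).2 hmod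
  have hn1 : ((n - 1 : ℕ) : ZMod ℓ) = -1 := by
    rw [Nat.cast_sub (by omega), hn0]; simp
  refine ⟨?_, ?_⟩
  · intro μ hμ j
    have hμ' : μ.rowLens = n :: (List.replicate 0 0 ++ if (0:ℕ) = 0 then [] else [0]) := by
      simpa [muList] using hμ
    have L := rowLen_form hμ'
    have L0 : μ.rowLen 0 = n := by simp [L]
    have L1 : ∀ r, 1 ≤ r → μ.rowLen r = 0 := by
      intro r hr
      rw [L]
      split_ifs <;> omega
    apply etilde_none
    intro r hr hres
    have : r = 0 := by
      by_contra h
      rw [L1 r (by omega)] at hr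
      omega
    subst this
    refine ⟨1, by omega, by simpa using hr, ?_, by intros; omega⟩
    rw [← hres, L0, hn0, L1 1 le_rfl]
    simp
  · intro i hi hiN μ μ' hμ hμ' j
    rw [hn1]
    obtain ⟨N, rfl⟩ := hmod
    rw [Nat.mul_div_cancel_left _ (by omega)] at hiN
    obtain ⟨k, rfl⟩ : ∃ k, i = k + 1 := ⟨i - 1, by omega⟩
    obtain ⟨e, rfl⟩ : ∃ e, N = e + (k + 1) := ⟨N - (k+1), by omega⟩
    obtain ⟨d, rfl⟩ : ∃ d, ℓ = d + 1 := ⟨ℓ - 1, by omega⟩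
    have hd : 1 ≤ d := by omega
    have hm : (d + 1) * (e + (k + 1)) - (e * (d + 1) + d) = k * (d + 1) + 1 := by
      have : (d + 1) * (e + (k + 1)) = (e * (d + 1) + d) + (k * (d + 1) + 1) := by ring
      omega
    have hμ1 : μ.rowLens = (e * (d + 1) + d) :: (List.replicate ((k * (d + 1) + 1) / d) d ++
        if (k * (d + 1) + 1) % d = 0 then [] else [(k * (d + 1) + 1) % d]) := by
      rw [hμ, muList, if_neg (by omega), Nat.mul_div_cancel_left _ (by omega)]
      simp only [Nat.add_sub_cancel, hm]
    have hμ2 : μ'.rowLens = (e * (d + 1) + d) :: (List.replicate ((k * (d + 1)) / d) d ++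
        if (k * (d + 1)) % d = 0 then [] else [(k * (d + 1)) % d]) := by
      rw [hμ', muList]
      simp only [Nat.add_sub_cancel]
      by_cases hk : k = 0
      · subst hk
        simp
        have : (d + 1) * (e + 1) = e * (d + 1) + d + 1 := by ring
        omega
      · rw [if_neg hk]
        have e1 : (d + 1) * (e + (k + 1)) - 1 = (d + 1) * (e + k) + d := by
          have : (d + 1) * (e + (k + 1)) = (d + 1) * (e + k) + d + 1 := by ring
          omega
        have e2 : ((d + 1) * (e + (k + 1)) - 1) / (d + 1) = e + k := by
          rw [e1, Nat.mul_add_div (by omega), Nat.div_eq_of_lt (by omega)]; simp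
        have e3 : (d + 1) * (e + (k + 1)) - 1 - (e * (d + 1) + d) = k * (d + 1) := by omega
        rw [e2, Nat.add_sub_cancel, e3]
    have hdz : (d : ZMod (d + 1)) = -1 := by
      push_cast at hℓ0
      linear_combination hℓ0
    refine core (d + 1) hd rfl (Nat.mod_lt _ hd) (Nat.mod_lt _ hd) ?_ (by omega) ?_ ?_ hμ1 hμ2 j
    · push_cast
      rw [hdz]; ring
    · have := congrArg (Nat.cast : ℕ → ZMod (d + 1)) (Nat.div_add_mod (k * (d + 1) + 1) d)
      rw [Nat.cast_add, Nat.cast_mul, hdz, Nat.cast_add, Nat.cast_mul, Nat.cast_add, hdz] at this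
      push_cast at this
      linear_combination this
    · have h1 := Nat.div_add_mod' (k * (d + 1) + 1) d
      have h2 := Nat.div_add_mod' (k * (d + 1)) d
      omega

end FockCrystal
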